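/- arXiv:0712.0914 — 12 statements merged into one kernel-verified Lean document; each statement's English description precedes it below -/
import Mathlib

section
/- Let A, B : K → K be linear maps on K = ℂⁿ such that the pair (A,B) has maximal rank. If Re(AB†) is negative semidefinite, then A − κB is invertible for every real κ > 0. -/
open ContinuousLinearMap

local notation "⟪" x ", " y "⟫" => @inner ℂ _ _ x y

/-- `K n = ℂⁿ` with the standard (Euclidean) inner product. -/
abbrev K (n : ℕ) := EuclideanSpace ℂ (Fin n)

/-- If the pair `(A,B)` has maximal rank, the adjoints of `A` and `B` have no common kernel. -/
theorem eq_zero_of_adjoint_eq_zero {n : ℕ} {A B : K n →L[ℂ] K n}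
    (hmax : Function.Surjective fun χ : K n × K n => A χ.1 + B χ.2) {x : K n}
    (hA : adjoint A x = 0) (hB : adjoint B x = 0) : x = 0 := by
  obtain ⟨χ, hχ⟩ := hmax x
  have h : ⟪x, A χ.1 + B χ.2⟫ = 0 := by
    rw [inner_add_right, ← adjoint_inner_left, ← adjoint_inner_left, hA, hB,
      inner_zero_left, inner_zero_left, add_zero]
  rw [show A χ.1 + B χ.2 = x from hχ] at h
  exact inner_self_eq_zero.mp h

/-- The quadratic form of `Re(AB†)` is `Re ⟪A†x, B†x⟫`. -/
theorem re_inner_half_add_adjoint {n : ℕ} (A B : K n →L[ℂ] K n) (x : K n) :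
    (⟪x, (((1:ℂ)/2) • (A ∘L adjoint B + adjoint (A ∘L adjoint B))) x⟫).re
      = (⟪adjoint A x, adjoint B x⟫).re := by
  have h₁ : ⟪x, (A ∘L adjoint B) x⟫ = ⟪adjoint A x, adjoint B x⟫ :=
    (adjoint_inner_left A _ _).symm
  have h₂ : (⟪x, adjoint (A ∘L adjoint B) x⟫).re = (⟪adjoint A x, adjoint B x⟫).re := by
    rw [adjoint_inner_right, ← h₁]
    exact inner_re_symm (𝕜 := ℂ) _ _
  have h₃ : ((1:ℂ)/2) = ((1/2 : ℝ) : ℂ) := by norm_num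
  rw [smul_apply, inner_smul_right, add_apply, inner_add_right, h₃, Complex.re_ofReal_mul,
    Complex.add_re, h₂, h₁]
  ring

/-- If the pair `(A,B)` has maximal rank and `Re(AB†) ≤ 0`, then `A - κB` is
invertible for every real `κ > 0`. -/
theorem stmt_0 {n : ℕ} (A B : K n →L[ℂ] K n)
    (hmax : Function.Surjective fun χ : K n × K n => A χ.1 + B χ.2)
    (hre : ∀ χ : K n,
      (⟪χ, (((1:ℂ)/2) • (A ∘L adjoint B + adjoint (A ∘L adjoint B))) χ⟫).re ≤ 0) :
    ∀ κ : ℝ, 0 < κ → IsUnit (A - (κ : ℂ) • B) := by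
  intro κ hκ
  rw [← isUnit_star, star_eq_adjoint, isUnit_iff_bijective]
  have hinj : Function.Injective (adjoint (A - (κ : ℂ) • B)) := by
    rw [injective_iff_map_eq_zero]
    intro x hx
    have hAB : adjoint A x = (κ : ℂ) • adjoint B x := by
      rw [map_sub, LinearIsometryEquiv.map_smulₛₗ, Complex.conj_ofReal, sub_apply,
        smul_apply] at hx
      exact sub_eq_zero.mp hx
    have h := hre x
    rw [re_inner_half_add_adjoint, hAB, inner_smul_left, Complex.conj_ofReal,
      Complex.re_ofReal_mul] at h
    have hB : adjoint B x = 0 :=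
      (re_inner_self_nonpos (𝕜 := ℂ)).mp (nonpos_of_mul_nonpos_right h hκ)
    exact eq_zero_of_adjoint_eq_zero hmax (by rw [hAB, hB, smul_zero]) hB
  exact ⟨hinj, LinearMap.injective_iff_surjective.mp hinj⟩
end

section
/- Let A, B : K → K be linear maps on K = ℂⁿ such that the pair (A,B) has maximal rank. If Im(AB†) is negative semidefinite, then A − i k B is invertible for every real k > 0. -/
open ContinuousLinearMap

local notation "⟪" x ", " y "⟫" => @inner ℂ _ _ x y

/-- A continuous linear endomorphism of a finite-dimensional Hilbert space is invertible as soon as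
its adjoint has trivial kernel. -/
theorem ContinuousLinearMap.isUnit_of_adjoint_ker_trivial {E : Type*} [NormedAddCommGroup E]
    [InnerProductSpace ℂ E] [FiniteDimensional ℂ E] [CompleteSpace E] (T : E →L[ℂ] E)
    (hT : ∀ x, adjoint T x = 0 → x = 0) : IsUnit T := by
  have hinj : Function.Injective (adjoint T) :=
    (injective_iff_map_eq_zero (adjoint T)).2 hT
  have hunit : IsUnit (star T) := ContinuousLinearMap.isUnit_iff_bijective.2
    ⟨hinj, LinearMap.injective_iff_surjective (f := (adjoint T : E →ₗ[ℂ] E)).1 hinj⟩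
  exact isUnit_star.1 hunit

/-- The quadratic form of `Im T = (T - T†) / (2i)` is the imaginary part of that of `T`. -/
theorem ContinuousLinearMap.re_inner_imaginaryPart {E : Type*} [NormedAddCommGroup E]
    [InnerProductSpace ℂ E] [CompleteSpace E] (T : E →L[ℂ] E) (x : E) :
    (⟪x, (((2 * Complex.I)⁻¹ : ℂ) • (T - adjoint T)) x⟫).re = (⟪x, T x⟫).im := by
  have hsymm : (⟪T x, x⟫).im = -(⟪x, T x⟫).im := inner_im_symm (𝕜 := ℂ) (T x) x
  rw [smul_apply, inner_smul_right, sub_apply, inner_sub_right, adjoint_inner_right]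
  simp [Complex.mul_re, Complex.inv_re, Complex.inv_im, hsymm]
  ring

/-- If the pair `(A,B)` has maximal rank and `Im(AB†) ≤ 0`, then `A - i k B` is
invertible for every real `k > 0`. -/
theorem stmt_1 {n : ℕ} (A B : K n →L[ℂ] K n)
    (hmax : Function.Surjective fun χ : K n × K n => A χ.1 + B χ.2)
    (him : ∀ χ : K n,
      (⟪χ, (((2 * Complex.I)⁻¹ : ℂ) •
          (A ∘L adjoint B - adjoint (A ∘L adjoint B))) χ⟫).re ≤ 0) :
    ∀ k : ℝ, 0 < k → IsUnit (A - (Complex.I * (k : ℂ)) • B) := by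
  intro k hk
  refine isUnit_of_adjoint_ker_trivial _ fun χ hχ => ?_
  have hA : adjoint A χ = -(Complex.I * (k : ℂ)) • adjoint B χ := by
    simp only [map_sub, map_smulₛₗ, sub_apply, smul_apply, map_mul, Complex.conj_I,
      Complex.conj_ofReal] at hχ
    rw [sub_eq_zero.1 hχ, neg_mul]
  have hform : (⟪χ, (A ∘L adjoint B) χ⟫).im = k * ‖adjoint B χ‖ ^ 2 := by
    rw [comp_apply, ← adjoint_inner_left, hA, inner_smul_left, inner_self_eq_norm_sq_to_K]
    simp [← Complex.ofReal_pow]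
  have hB : adjoint B χ = 0 := by
    have hle := him χ
    rw [re_inner_imaginaryPart, hform] at hle
    have hsq : ‖adjoint B χ‖ ^ 2 ≤ 0 := nonpos_of_mul_nonpos_right hle hk
    simpa using le_antisymm hsq (sq_nonneg _)
  rw [hB, smul_zero] at hA
  obtain ⟨p, hp⟩ := hmax χ
  have hself : ⟪χ, A p.1 + B p.2⟫ = 0 := by
    rw [inner_add_right, ← adjoint_inner_left, ← adjoint_inner_left, hA, hB]
    simp
  exact inner_self_eq_zero.1 ((congrArg (fun y => ⟪χ, y⟫) hp).symm.trans hself)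
end

section
/- Let A, B : K → K be linear maps on K = ℂⁿ such that the pair (A,B) has maximal rank. If Re(AB†) is negative semidefinite, then for every real κ > 0 the operator A − κB is invertible and the operator 𝔖(iκ;A,B) := −(A − κB)^{−1}(A + κB) is a contraction, i.e., its operator norm (induced by the Euclidean norm on ℂⁿ) is at most 1. -/
open ContinuousLinearMap

local notation "⟪" x ", " y "⟫" => @inner ℂ _ _ x y

/-- If `Re ⟪x, y⟫ ≤ 0`, then moving from `x` towards `y` is no longer than moving away from it. -/
theorem norm_add_smul_le_norm_sub_smul {E : Type*} [NormedAddCommGroup E] [InnerProductSpace ℂ E]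
    {x y : E} {κ : ℝ} (hκ : 0 ≤ κ) (h : (inner ℂ x y).re ≤ 0) :
    ‖x + (κ : ℂ) • y‖ ≤ ‖x - (κ : ℂ) • y‖ := by
  refine le_of_sq_le_sq ?_ (norm_nonneg _)
  rw [@norm_add_sq ℂ, @norm_sub_sq ℂ, inner_smul_right, RCLike.re_to_complex,
    Complex.re_ofReal_mul]
  nlinarith [mul_nonpos_of_nonneg_of_nonpos hκ h]

/-- An operator on a finite-dimensional space is invertible if its adjoint is injective. -/
theorem isUnit_of_injective_adjoint {E : Type*} [NormedAddCommGroup E] [InnerProductSpace ℂ E]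
    [FiniteDimensional ℂ E] [CompleteSpace E] {M : E →L[ℂ] E}
    (h : Function.Injective (adjoint M)) : IsUnit M := by
  rw [← isUnit_star, star_eq_adjoint, isUnit_iff_bijective]
  exact ⟨h, LinearMap.surjective_of_injective (f := (adjoint M).toLinearMap) h⟩

/-- If `‖P† x‖ ≤ ‖M† x‖` for all `x` and `M` is invertible, then `M⁻¹ P` is a contraction. -/
theorem norm_inverse_comp_le_one {E : Type*} [NormedAddCommGroup E] [InnerProductSpace ℂ E]
    [CompleteSpace E] {M P : E →L[ℂ] E} (hM : IsUnit M)
    (h : ∀ x, ‖adjoint P x‖ ≤ ‖adjoint M x‖) : ‖Ring.inverse M ∘L P‖ ≤ 1 := by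
  rw [← LinearIsometryEquiv.norm_map adjoint]
  refine opNorm_le_bound _ zero_le_one fun y => ?_
  obtain ⟨x, rfl⟩ : ∃ x, adjoint M x = y :=
    (isUnit_iff_bijective.1 (star_eq_adjoint M ▸ hM.star)).2 y
  rw [one_mul, ← comp_apply, ← adjoint_comp]
  have hMP : M ∘L (Ring.inverse M ∘L P) = P := Ring.mul_inverse_cancel_left M P hM
  rw [hMP]
  exact h x

/-- If the pair `(A,B)` has maximal rank and `Re(AB†) ≤ 0`, then for every real
`κ > 0` the operator `A - κB` is invertible and
`𝔖(iκ;A,B) = -(A-κB)⁻¹(A+κB)` is a contraction. -/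
theorem stmt_3 {n : ℕ} (A B : K n →L[ℂ] K n)
    (hmax : Function.Surjective fun χ : K n × K n => A χ.1 + B χ.2)
    (hre : ∀ χ : K n,
      (⟪χ, (((1:ℂ)/2) • (A ∘L adjoint B + adjoint (A ∘L adjoint B))) χ⟫).re ≤ 0) :
    ∀ κ : ℝ, 0 < κ →
      IsUnit (A - (κ : ℂ) • B) ∧
      ‖-(Ring.inverse (A - (κ : ℂ) • B) ∘L (A + (κ : ℂ) • B))‖ ≤ 1 := by
  intro κ hκ
  have hAB (χ : K n) : (⟪adjoint A χ, adjoint B χ⟫).re ≤ 0 := by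
    have h := hre χ
    rw [smul_apply, add_apply, inner_smul_right, inner_add_right, adjoint_inner_right,
      ← inner_conj_symm ((A ∘L adjoint B) χ) χ, comp_apply, ← adjoint_inner_left,
      Complex.add_conj] at h
    norm_num at h
    linarith
  have hadjP (χ : K n) :
      adjoint (A + (κ : ℂ) • B) χ = adjoint A χ + (κ : ℂ) • adjoint B χ := by
    rw [map_add, map_smulₛₗ, Complex.conj_ofReal, add_apply, smul_apply]
  have hadjM (χ : K n) :
      adjoint (A - (κ : ℂ) • B) χ = adjoint A χ - (κ : ℂ) • adjoint B χ := by
    rw [map_sub, map_smulₛₗ, Complex.conj_ofReal, sub_apply, smul_apply]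
  have hle (χ : K n) : ‖adjoint (A + (κ : ℂ) • B) χ‖ ≤ ‖adjoint (A - (κ : ℂ) • B) χ‖ := by
    rw [hadjP, hadjM]
    exact norm_add_smul_le_norm_sub_smul hκ.le (hAB χ)
  have hunit : IsUnit (A - (κ : ℂ) • B) := by
    refine isUnit_of_injective_adjoint ((injective_iff_map_eq_zero _).2 fun χ hχ => ?_)
    have hadd : adjoint (A + (κ : ℂ) • B) χ = 0 :=
      norm_le_zero_iff.1 ((hle χ).trans_eq (by rw [hχ, norm_zero]))
    rw [hadjP] at hadd
    rw [hadjM] at hχ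
    have hA : adjoint A χ = 0 := by
      have h2 : (2 : ℂ) • adjoint A χ = 0 := by
        linear_combination (norm := module) hχ + hadd
      simpa using h2
    have hB : adjoint B χ = 0 := by simpa [hA, hκ.ne'] using hadd
    obtain ⟨⟨x, y⟩, hxy⟩ := hmax χ
    rw [← inner_self_eq_zero (𝕜 := ℂ)]
    nth_rewrite 2 [← hxy]
    rw [inner_add_right, ← adjoint_inner_left, ← adjoint_inner_left, hA, hB]
    simp
  exact ⟨hunit, (norm_neg _).trans_le (norm_inverse_comp_le_one hunit hle)⟩
end

section
/- Let A, B : K → K be linear maps on K = ℂⁿ such that the pair (A,B) has maximal rank. Suppose that for some real κ₀ > 0 the operator A − κ₀B is invertible and the operator norm (induced by the Euclidean norm on ℂⁿ) of (A − κ₀B)^{−1}(A + κ₀B) is at most 1. Then Re(AB†) is negative semidefinite. -/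
open ContinuousLinearMap

local notation "⟪" x ", " y "⟫" => @inner ℂ _ _ x y

/-- If `A - B` is invertible and `(A - B)⁻¹ (A + B)` is a contraction, then `A†χ` and `B†χ` have
nonpositive real inner product. -/
theorem re_inner_adjoint_nonpos_of_norm_inverse_comp_le_one
    {E : Type*} [NormedAddCommGroup E] [InnerProductSpace ℂ E] [CompleteSpace E]
    (A B : E →L[ℂ] E) (hunit : IsUnit (A - B))
    (hcontr : ‖Ring.inverse (A - B) ∘L (A + B)‖ ≤ 1) (χ : E) :
    (⟪adjoint A χ, adjoint B χ⟫).re ≤ 0 := by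
  set S := Ring.inverse (A - B) ∘L (A + B)
  have hcomp : (A - B) ∘L S = A + B := Ring.mul_inverse_cancel_left (A - B) (A + B) hunit
  have hadj : adjoint S (adjoint (A - B) χ) = adjoint (A + B) χ := by
    rw [← hcomp, adjoint_comp (A - B) S, comp_apply]
  have hle : ‖adjoint A χ + adjoint B χ‖ ≤ ‖adjoint A χ - adjoint B χ‖ := by
    have h := (adjoint S).le_of_opNorm_le (by simpa using hcontr) (adjoint (A - B) χ)
    rw [hadj] at h
    simpa using h
  have hsq := pow_le_pow_left₀ (norm_nonneg _) hle 2
  rw [norm_add_sq (𝕜 := ℂ), norm_sub_sq (𝕜 := ℂ)] at hsq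
  simp only [RCLike.re_to_complex] at hsq
  linarith

/-- If the pair `(A,B)` has maximal rank and for some real `κ₀ > 0` the operator
`A - κ₀B` is invertible with `‖(A-κ₀B)⁻¹(A+κ₀B)‖ ≤ 1`, then `Re(AB†) ≤ 0`. -/
theorem stmt_4 {n : ℕ} (A B : K n →L[ℂ] K n)
    (hmax : Function.Surjective fun χ : K n × K n => A χ.1 + B χ.2)
    (κ₀ : ℝ) (hκ₀ : 0 < κ₀)
    (hunit : IsUnit (A - (κ₀ : ℂ) • B))
    (hcontr : ‖Ring.inverse (A - (κ₀ : ℂ) • B) ∘L (A + (κ₀ : ℂ) • B)‖ ≤ 1) :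
    ∀ χ : K n,
      (⟪χ, (((1:ℂ)/2) • (A ∘L adjoint B + adjoint (A ∘L adjoint B))) χ⟫).re ≤ 0 := by
  intro χ
  have h := re_inner_adjoint_nonpos_of_norm_inverse_comp_le_one A ((κ₀ : ℂ) • B) hunit hcontr χ
  have hAB : (⟪adjoint A χ, adjoint B χ⟫).re ≤ 0 := by
    have h' : κ₀ * (⟪adjoint A χ, adjoint B χ⟫).re ≤ 0 := by
      simpa [map_smulₛₗ, inner_smul_right] using h
    exact nonpos_of_mul_nonpos_right h' hκ₀
  have hre : (⟪χ, (((1:ℂ)/2) • (A ∘L adjoint B + adjoint (A ∘L adjoint B))) χ⟫).re =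
      (⟪adjoint A χ, adjoint B χ⟫).re := by
    have hsymm : (⟪adjoint B χ, adjoint A χ⟫).re = (⟪adjoint A χ, adjoint B χ⟫).re :=
      inner_re_symm (𝕜 := ℂ) _ _
    have hhalf : ((1:ℂ)/2) = ((1/2 : ℝ) : ℂ) := by norm_num
    rw [hhalf, adjoint_comp, adjoint_adjoint, smul_apply, add_apply, comp_apply, comp_apply,
      inner_smul_right, inner_add_right, ← adjoint_inner_left A, ← adjoint_inner_left B,
      Complex.re_ofReal_mul, Complex.add_re, hsymm]
    ring
  rw [hre]
  exact hAB
end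

section
/- Let A, B : K → K be linear maps on K = ℂⁿ such that the pair (A,B) has maximal rank. If Im(AB†) is negative semidefinite, then for every real k > 0 the operator A − i k B is invertible and the operator 𝔖(−k;A,B) := −(A − i k B)^{−1}(A + i k B) is a contraction, i.e., its operator norm (induced by the Euclidean norm on ℂⁿ) is at most 1. -/
open ContinuousLinearMap

local notation "⟪" x ", " y "⟫" => @inner ℂ _ _ x y

/-- The quadratic form of `Im(AB†)` at `χ` is `Im⟪A†χ, B†χ⟫`. -/
lemma inner_imaginary_part_comp_adjoint {n : ℕ} (A B : K n →L[ℂ] K n) (χ : K n) :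
    (⟪χ, (((2 * Complex.I)⁻¹ : ℂ) •
        (A ∘L adjoint B - adjoint (A ∘L adjoint B))) χ⟫).re
      = (⟪adjoint A χ, adjoint B χ⟫).im := by
  have h : ⟪χ, (adjoint (A ∘L adjoint B)) χ⟫ = ⟪adjoint B χ, adjoint A χ⟫ := by
    rw [adjoint_inner_right, ContinuousLinearMap.comp_apply, ← adjoint_inner_right]
  rw [smul_apply, sub_apply, inner_smul_right, inner_sub_right, h,
    ContinuousLinearMap.comp_apply, ← adjoint_inner_left, ← inner_conj_symm (adjoint B χ),
    Complex.sub_conj]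
  have h2 : (2 * Complex.I)⁻¹ * (↑(2 * (⟪adjoint A χ, adjoint B χ⟫).im) * Complex.I)
      = ((⟪adjoint A χ, adjoint B χ⟫).im : ℂ) := by
    push_cast
    field_simp
  rw [h2, Complex.ofReal_re]

lemma norm_add_I_mul_smul_sq {E : Type*} [NormedAddCommGroup E] [InnerProductSpace ℂ E]
    (a b : E) (k : ℝ) :
    ‖a + (Complex.I * (k : ℂ)) • b‖ ^ 2
      = ‖a‖ ^ 2 + k ^ 2 * ‖b‖ ^ 2 - 2 * k * (⟪a, b⟫).im := by
  rw [@norm_add_sq ℂ, inner_smul_right, norm_smul]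
  simp [mul_pow]
  ring

lemma adjoint_sub_I_mul_smul {n : ℕ} (A B : K n →L[ℂ] K n) (k : ℝ) (χ : K n) :
    adjoint (A - (Complex.I * (k : ℂ)) • B) χ
      = adjoint A χ + (Complex.I * (k : ℂ)) • adjoint B χ := by
  simp [map_sub, map_smulₛₗ]

lemma adjoint_add_I_mul_smul {n : ℕ} (A B : K n →L[ℂ] K n) (k : ℝ) (χ : K n) :
    adjoint (A + (Complex.I * (k : ℂ)) • B) χ
      = adjoint A χ + (Complex.I * ((-k : ℝ) : ℂ)) • adjoint B χ := by
  simp [map_add, map_smulₛₗ]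

lemma eq_zero_of_adjoint_apply_eq_zero {n : ℕ} {A B : K n →L[ℂ] K n}
    (hmax : Function.Surjective fun χ : K n × K n => A χ.1 + B χ.2) {χ : K n}
    (hA : adjoint A χ = 0) (hB : adjoint B χ = 0) : χ = 0 := by
  obtain ⟨p, hp⟩ := hmax χ
  rw [← inner_self_eq_zero (𝕜 := ℂ)]
  nth_rewrite 2 [← hp]
  simp [inner_add_right, ← adjoint_inner_left, hA, hB]

lemma isUnit_of_adjoint_injective {n : ℕ} {M : K n →L[ℂ] K n}
    (h : ∀ χ, adjoint M χ = 0 → χ = 0) : IsUnit M := by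
  have hu : IsUnit (adjoint M) := by
    rw [ContinuousLinearMap.isUnit_iff_bijective]
    have hi : Function.Injective (adjoint M : K n →ₗ[ℂ] K n) :=
      (injective_iff_map_eq_zero _).2 h
    exact ⟨hi, LinearMap.injective_iff_surjective.1 hi⟩
  rw [← star_eq_adjoint] at hu
  exact isUnit_star.1 hu

/-- If `‖N†χ‖ ≤ ‖M†χ‖` for all `χ` and `M` is invertible, then `M⁻¹N` is a contraction. -/
lemma norm_inverse_comp_le_one_s5 {n : ℕ} {M N : K n →L[ℂ] K n} (hM : IsUnit M)
    (h : ∀ χ, ‖adjoint N χ‖ ≤ ‖adjoint M χ‖) : ‖Ring.inverse M ∘L N‖ ≤ 1 := by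
  rw [← LinearIsometryEquiv.norm_map adjoint, adjoint_comp]
  refine opNorm_le_bound _ zero_le_one fun y => ?_
  have hy : adjoint M (adjoint (Ring.inverse M) y) = y := by
    rw [← ContinuousLinearMap.comp_apply, ← adjoint_comp]
    change adjoint (Ring.inverse M * M) y = y
    rw [Ring.inverse_mul_cancel _ hM, ← star_eq_adjoint, star_one]
    rfl
  simpa [hy] using h (adjoint (Ring.inverse M) y)

/-- If the pair `(A,B)` has maximal rank and `Im(AB†) ≤ 0`, then for every real
`k > 0` the operator `A - i k B` is invertible and
`𝔖(-k;A,B) = -(A - i k B)⁻¹(A + i k B)` is a contraction. -/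
theorem stmt_5 {n : ℕ} (A B : K n →L[ℂ] K n)
    (hmax : Function.Surjective fun χ : K n × K n => A χ.1 + B χ.2)
    (him : ∀ χ : K n,
      (⟪χ, (((2 * Complex.I)⁻¹ : ℂ) •
          (A ∘L adjoint B - adjoint (A ∘L adjoint B))) χ⟫).re ≤ 0) :
    ∀ k : ℝ, 0 < k →
      IsUnit (A - (Complex.I * (k : ℂ)) • B) ∧
      ‖-(Ring.inverse (A - (Complex.I * (k : ℂ)) • B) ∘L
          (A + (Complex.I * (k : ℂ)) • B))‖ ≤ 1 := by
  intro k hk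
  have him' (χ : K n) : (⟪adjoint A χ, adjoint B χ⟫).im ≤ 0 :=
    (inner_imaginary_part_comp_adjoint A B χ).symm.trans_le (him χ)
  have hunit : IsUnit (A - (Complex.I * (k : ℂ)) • B) := by
    refine isUnit_of_adjoint_injective fun χ hχ => ?_
    have h := norm_add_I_mul_smul_sq (adjoint A χ) (adjoint B χ) k
    rw [← adjoint_sub_I_mul_smul, hχ, norm_zero] at h
    have hq := mul_nonneg hk.le (neg_nonneg.2 (him' χ))
    have hb : 0 ≤ k ^ 2 * ‖adjoint B χ‖ ^ 2 := by positivity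
    have hA : ‖adjoint A χ‖ ^ 2 = 0 := by nlinarith [sq_nonneg ‖adjoint A χ‖]
    have hB : k ^ 2 * ‖adjoint B χ‖ ^ 2 = 0 := by nlinarith
    exact eq_zero_of_adjoint_apply_eq_zero hmax (by simpa using hA)
      (by simpa [hk.ne'] using hB)
  refine ⟨hunit, ?_⟩
  rw [norm_neg]
  refine norm_inverse_comp_le_one_s5 hunit fun χ => ?_
  refine (sq_le_sq₀ (norm_nonneg _) (norm_nonneg _)).1 ?_
  rw [adjoint_sub_I_mul_smul, adjoint_add_I_mul_smul, norm_add_I_mul_smul_sq,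
    norm_add_I_mul_smul_sq]
  nlinarith [mul_nonneg hk.le (neg_nonneg.2 (him' χ))]
end

section
/- Let A, B : K → K be linear maps on K = ℂⁿ such that the pair (A,B) has maximal rank. Suppose that for some real k₀ > 0 the operator A − i k₀ B is invertible and the operator norm (induced by the Euclidean norm on ℂⁿ) of (A − i k₀ B)^{−1}(A + i k₀ B) is at most 1. Then Im(AB†) is negative semidefinite. -/
open ContinuousLinearMap

local notation "⟪" x ", " y "⟫" => @inner ℂ _ _ x y

/-- If `‖a - i k b‖ ≤ ‖a + i k b‖` with `k > 0`, then `Im ⟨a, b⟩ ≤ 0`. -/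
theorem im_inner_nonpos_of_norm_sub_le_norm_add {E : Type*} [NormedAddCommGroup E]
    [InnerProductSpace ℂ E] {a b : E} {k : ℝ} (hk : 0 < k)
    (h : ‖a - (Complex.I * (k : ℂ)) • b‖ ≤ ‖a + (Complex.I * (k : ℂ)) • b‖) :
    (inner ℂ a b).im ≤ 0 := by
  have hsq := pow_le_pow_left₀ (norm_nonneg _) h 2
  rw [@norm_sub_sq ℂ, @norm_add_sq ℂ, inner_smul_right] at hsq
  simp at hsq
  nlinarith

/-- If `M` is invertible and `M⁻¹ N` is a contraction, then `‖N† x‖ ≤ ‖M† x‖` for all `x`. -/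
theorem norm_adjoint_apply_le_of_norm_inverse_comp_le_one {E : Type*} [NormedAddCommGroup E]
    [InnerProductSpace ℂ E] [CompleteSpace E] {M N : E →L[ℂ] E} (hM : IsUnit M)
    (h : ‖Ring.inverse M ∘L N‖ ≤ 1) (x : E) : ‖adjoint N x‖ ≤ ‖adjoint M x‖ := by
  have hN : N = M ∘L (Ring.inverse M ∘L N) :=
    (Ring.mul_inverse_cancel_left M N hM).symm
  have hadj : adjoint N x = adjoint (Ring.inverse M ∘L N) (adjoint M x) := by
    conv_lhs => rw [hN, adjoint_comp]
    rfl
  rw [hadj]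
  refine (le_of_opNorm_le _ (c := 1) ?_ _).trans_eq (one_mul _)
  rwa [LinearIsometryEquiv.norm_map]

/-- If the pair `(A,B)` has maximal rank and for some real `k₀ > 0` the operator
`A - i k₀ B` is invertible with `‖(A - i k₀ B)⁻¹(A + i k₀ B)‖ ≤ 1`,
then `Im(AB†) ≤ 0`. -/
theorem stmt_6 {n : ℕ} (A B : K n →L[ℂ] K n)
    (hmax : Function.Surjective fun χ : K n × K n => A χ.1 + B χ.2)
    (k₀ : ℝ) (hk₀ : 0 < k₀)
    (hunit : IsUnit (A - (Complex.I * (k₀ : ℂ)) • B))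
    (hcontr : ‖Ring.inverse (A - (Complex.I * (k₀ : ℂ)) • B) ∘L
        (A + (Complex.I * (k₀ : ℂ)) • B)‖ ≤ 1) :
    ∀ χ : K n,
      (⟪χ, (((2 * Complex.I)⁻¹ : ℂ) •
          (A ∘L adjoint B - adjoint (A ∘L adjoint B))) χ⟫).re ≤ 0 := by
  intro χ
  have hnorm := norm_adjoint_apply_le_of_norm_inverse_comp_le_one hunit hcontr χ
  have him : (inner ℂ (adjoint A χ) (adjoint B χ)).im ≤ 0 := by
    refine im_inner_nonpos_of_norm_sub_le_norm_add hk₀ ?_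
    simpa [map_add, map_sub, LinearIsometryEquiv.map_smulₛₗ, sub_eq_add_neg] using hnorm
  have hAB : inner ℂ χ ((A ∘L adjoint B) χ) = inner ℂ (adjoint A χ) (adjoint B χ) := by
    rw [comp_apply, adjoint_inner_left]
  have hBA : inner ℂ χ (adjoint (A ∘L adjoint B) χ) =
      (starRingEnd ℂ) (inner ℂ (adjoint A χ) (adjoint B χ)) := by
    rw [adjoint_inner_right, ← inner_conj_symm, hAB]
  rw [smul_apply, sub_apply, inner_smul_right, inner_sub_right, hAB, hBA, Complex.sub_conj]
  have hI : (2 * Complex.I)⁻¹ *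
      (((2 * (inner ℂ (adjoint A χ) (adjoint B χ)).im : ℝ) : ℂ) * Complex.I) =
      ((inner ℂ (adjoint A χ) (adjoint B χ)).im : ℂ) := by
    push_cast
    field_simp [Complex.I_ne_zero]
  rw [hI]
  exact him
end

section
/- Let A, B : K → K be linear maps on K = ℂⁿ such that the pair (A,B) has maximal rank. Let Q be the operator on K ⊕ K given by Q(χ₁,χ₂) := (χ₂, 0), let M := {(χ₁,χ₂) ∈ K ⊕ K : Aχ₁ + Bχ₂ = 0}, and let P_M be the orthogonal projection of K ⊕ K onto M. Then Re(P_M Q P_M) is positive semidefinite if and only if Re(AB†) is negative semidefinite. -/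
open ContinuousLinearMap

local notation "⟪" x ", " y "⟫" => @inner ℂ _ _ x y

/-- Expansion of the form `(u, v) ↦ Re ⟪u, v⟫` at a difference of two pairs. -/
lemma re_inner_sub_sub {E : Type*} [NormedAddCommGroup E] [InnerProductSpace ℂ E]
    (y₁ y₂ m₁ m₂ : E) :
    (⟪y₁ - m₁, y₂ - m₂⟫).re
      = (⟪y₁, y₂⟫).re + (⟪m₁, m₂⟫).re - (⟪m₁, y₂⟫ + ⟪m₂, y₁⟫).re := by
  have h : (⟪y₁, m₂⟫).re = (⟪m₂, y₁⟫).re := inner_re_symm (𝕜 := ℂ) y₁ m₂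
  simp only [inner_sub_left, inner_sub_right, Complex.sub_re, Complex.add_re, h]
  ring

/-- The real part of `⟪u, u⟫` is nonnegative. -/
lemma re_inner_self_nonneg {E : Type*} [NormedAddCommGroup E] [InnerProductSpace ℂ E]
    (u : E) : 0 ≤ (⟪u, u⟫).re :=
  inner_self_nonneg (𝕜 := ℂ) (x := u)

/-- A vector with `Re ⟪u, u⟫ ≤ 0` vanishes. -/
lemma eq_zero_of_re_inner_self_nonpos {E : Type*} [NormedAddCommGroup E]
    [InnerProductSpace ℂ E] {u : E} (h : (⟪u, u⟫).re ≤ 0) : u = 0 :=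
  re_inner_self_nonpos (𝕜 := ℂ).1 h

/-- An injective endomorphism of `ℂⁿ` is surjective. -/
lemma surjective_of_ker_trivial {n : ℕ} (T : K n →L[ℂ] K n) (h : ∀ u, T u = 0 → u = 0) :
    Function.Surjective T :=
  LinearMap.injective_iff_surjective.1
    ((injective_iff_map_eq_zero (T : K n →ₗ[ℂ] K n)).2 h)

/-- `(A†χ, B†χ)` is orthogonal to every `(u, v)` with `A u + B v = 0`. -/
lemma inner_adjoint_add_inner_adjoint_eq_zero {n : ℕ} (A B : K n →L[ℂ] K n) {u v : K n}
    (h : A u + B v = 0) (χ : K n) : ⟪u, adjoint A χ⟫ + ⟪v, adjoint B χ⟫ = 0 := by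
  rw [adjoint_inner_right, adjoint_inner_right, ← inner_add_left, h, inner_zero_left]

/-- The form `Re ⟪u, v⟫` is nonnegative on the kernel of `(A, B)` if and only if it is nonpositive
on the range of `(A†, B†)`. -/
lemma re_inner_nonneg_on_ker_iff {n : ℕ} (A B : K n →L[ℂ] K n)
    (hmax : Function.Surjective fun χ : K n × K n => A χ.1 + B χ.2) :
    (∀ u v : K n, A u + B v = 0 → 0 ≤ (⟪u, v⟫).re) ↔
      ∀ χ : K n, (⟪adjoint B χ, adjoint A χ⟫).re ≤ 0 := by
  constructor
  · intro h χ
    have hsurj : Function.Surjective (A - B) := by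
      refine surjective_of_ker_trivial _ fun u hu => eq_zero_of_re_inner_self_nonpos ?_
      have := h u (-u) (by simpa [sub_eq_add_neg] using hu)
      rw [inner_neg_right, Complex.neg_re] at this
      linarith
    obtain ⟨u, hu⟩ := hsurj (-B (adjoint B χ + adjoint A χ))
    set v := adjoint B χ + adjoint A χ - u with hv
    have hm : A u + B v = 0 := by
      rw [sub_apply] at hu
      rw [hv, map_sub, ← neg_eq_iff_eq_neg.2 hu]
      abel
    have key := re_inner_sub_sub (adjoint B χ) (adjoint A χ) u v
    rw [inner_adjoint_add_inner_adjoint_eq_zero A B hm,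
      show adjoint A χ - v = -(adjoint B χ - u) by rw [hv]; abel, inner_neg_right,
      Complex.neg_re, Complex.zero_re] at key
    linarith [h u v hm, re_inner_self_nonneg (adjoint B χ - u)]
  · intro h u v hm
    have hsurj : Function.Surjective (adjoint B - adjoint A) := by
      refine surjective_of_ker_trivial _ fun χ hχ => ?_
      have hBA : adjoint B χ = adjoint A χ := sub_eq_zero.1 hχ
      have hA : adjoint A χ = 0 := by
        have := h χ
        rw [hBA] at this
        exact eq_zero_of_re_inner_self_nonpos this
      obtain ⟨w, hw⟩ := hmax χ
      refine inner_self_eq_zero (𝕜 := ℂ).1 ?_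
      nth_rewrite 1 [← hw]
      rw [inner_add_left, ← adjoint_inner_right, ← adjoint_inner_right, hBA, hA]
      simp
    obtain ⟨χ, hχ⟩ := hsurj (u - v)
    rw [sub_apply] at hχ
    have key := re_inner_sub_sub (adjoint B χ) (adjoint A χ) u v
    rw [inner_adjoint_add_inner_adjoint_eq_zero A B hm,
      show adjoint A χ - v = adjoint B χ - u by
        rw [sub_eq_sub_iff_add_eq_add, ← sub_eq_zero]
        rw [← sub_eq_zero] at hχ
        rw [← neg_eq_zero, ← hχ]
        abel, Complex.zero_re] at key
    linarith [h χ, re_inner_self_nonneg (adjoint B χ - u)]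

/-- The quadratic form of `Re (A B†)` is `χ ↦ Re ⟪B†χ, A†χ⟫`. -/
lemma re_inner_half_smul_comp_adjoint {n : ℕ} (A B : K n →L[ℂ] K n) (χ : K n) :
    (⟪χ, (((1:ℂ)/2) • (A ∘L adjoint B + adjoint (A ∘L adjoint B))) χ⟫).re
      = (⟪adjoint B χ, adjoint A χ⟫).re := by
  have h₁ : ⟪χ, A (adjoint B χ)⟫ = ⟪adjoint A χ, adjoint B χ⟫ := (adjoint_inner_left A _ _).symm
  have h₂ : ⟪χ, B (adjoint A χ)⟫ = ⟪adjoint B χ, adjoint A χ⟫ := (adjoint_inner_left B _ _).symm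
  have h₃ : (⟪adjoint A χ, adjoint B χ⟫).re = (⟪adjoint B χ, adjoint A χ⟫).re :=
    inner_re_symm (𝕜 := ℂ) _ _
  rw [adjoint_comp, adjoint_adjoint, smul_apply, add_apply, comp_apply, comp_apply,
    inner_smul_right, inner_add_right, h₁, h₂, show (1 / 2 : ℂ) = ((1 / 2 : ℝ) : ℂ) by simp,
    Complex.re_ofReal_mul, Complex.add_re, h₃]
  ring

/-- Let `(A,B)` have maximal rank, `Q(χ₁,χ₂) := (χ₂,0)` on `K ⊕ K`,
`M := {(χ₁,χ₂) : Aχ₁ + Bχ₂ = 0}`, and let `P` be the orthogonal projection of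
`K ⊕ K` onto `M` (characterized by: `P` maps into `M`, fixes `M`, and is
self-adjoint with respect to the direct-sum inner product). Then
`Re(P Q P) ≥ 0` iff `Re(AB†) ≤ 0`. Here the quadratic form of `Re(P Q P)` at
`x` is the real part of `⟨x, PQPx⟩` in the direct-sum inner product. -/
theorem stmt_9 {n : ℕ} (A B : K n →L[ℂ] K n)
    (hmax : Function.Surjective fun χ : K n × K n => A χ.1 + B χ.2)
    (P : (K n × K n) →ₗ[ℂ] (K n × K n))
    (hPmem : ∀ x : K n × K n, A (P x).1 + B (P x).2 = 0)
    (hPfix : ∀ x : K n × K n, A x.1 + B x.2 = 0 → P x = x)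
    (hPsa : ∀ x y : K n × K n,
      ⟪(P x).1, y.1⟫ + ⟪(P x).2, y.2⟫ = ⟪x.1, (P y).1⟫ + ⟪x.2, (P y).2⟫) :
    (∀ x : K n × K n,
        0 ≤ (⟪x.1, (P ((P x).2, 0)).1⟫ + ⟪x.2, (P ((P x).2, 0)).2⟫).re) ↔
    (∀ χ : K n,
        (⟪χ, (((1:ℂ)/2) • (A ∘L adjoint B + adjoint (A ∘L adjoint B))) χ⟫).re ≤ 0) := by
  simp only [re_inner_half_smul_comp_adjoint]
  rw [← re_inner_nonneg_on_ker_iff A B hmax]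
  have hform (x : K n × K n) :
      ⟪x.1, (P ((P x).2, 0)).1⟫ + ⟪x.2, (P ((P x).2, 0)).2⟫ = ⟪(P x).1, (P x).2⟫ := by
    rw [← hPsa, inner_zero_right, add_zero]
  simp only [hform]
  refine ⟨fun h u v huv => ?_, fun h x => h _ _ (hPmem x)⟩
  simpa only [hPfix (u, v) huv] using h (u, v)
end

section
/- Let h, g ∈ ℂⁿ with h ≠ 0 and ⟨g,h⟩ ≠ 0, let A := I − ‖h‖^{−2} h⟨h,·⟩ (the orthogonal projection onto the orthogonal complement of h), and let B be the rank-one map Bx := ⟨g,x⟩h. Then for every k ∈ ℂ with k ≠ 0, the operator A + ikB is invertible and −(A + ikB)^{−1}(A − ikB) = −I + (2/⟨g,h⟩) h⟨g,·⟩, i.e., the map x ↦ −x + (2/⟨g,h⟩) ⟨g,x⟩ h; in particular this operator is independent of k. -/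
open ContinuousLinearMap

local notation "⟪" x ", " y "⟫" => @inner ℂ _ _ x y

/-- If the idempotents `p` and `q` satisfy `p * q = q` and `q * p = p`, then `1 - p + z • q` is a
unit for `z ≠ 0`, with inverse `1 - q + z⁻¹ • p`. -/
def unitOfIdempotentPair {𝕜 R : Type*} [Field 𝕜] [Ring R] [Algebra 𝕜 R] {p q : R}
    (hp : p * p = p) (hq : q * q = q) (hpq : p * q = q) (hqp : q * p = p) {z : 𝕜} (hz : z ≠ 0) :
    Rˣ where
  val := 1 - p + z • q
  inv := 1 - q + z⁻¹ • p
  val_inv := by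
    simp [mul_add, add_mul, mul_sub, sub_mul, hp, hq, hpq, hqp, smul_smul, hz]
  inv_val := by
    simp [mul_add, add_mul, mul_sub, sub_mul, hp, hq, hpq, hqp, smul_smul, hz]

theorem neg_inverse_mul_of_idempotent_pair {𝕜 R : Type*} [Field 𝕜] [Ring R] [Algebra 𝕜 R]
    {p q : R} (hp : p * p = p) (hq : q * q = q) (hpq : p * q = q) (hqp : q * p = p)
    {z : 𝕜} (hz : z ≠ 0) :
    IsUnit (1 - p + z • q) ∧
      -(Ring.inverse (1 - p + z • q) * (1 - p - z • q)) = -1 + (2 : 𝕜) • q := by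
  let u := unitOfIdempotentPair hp hq hpq hqp hz
  have hu : (u : R) = 1 - p + z • q := rfl
  have hinv : (↑u⁻¹ : R) = 1 - q + z⁻¹ • p := rfl
  rw [← hu, Ring.inverse_unit, hinv]
  refine ⟨u.isUnit, ?_⟩
  simp [add_mul, mul_sub, sub_mul, hp, hq, hpq, hqp, smul_smul, hz, two_smul]
  abel

/-- Rank-one operators with the same range vector compose by scaling. -/
theorem innerSL_smulRight_mul {E : Type*} [NormedAddCommGroup E] [InnerProductSpace ℂ E]
    (a b h : E) :
    (innerSL ℂ a).smulRight h * (innerSL ℂ b).smulRight h =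
      ⟪a, h⟫ • (innerSL ℂ b).smulRight h := by
  ext x
  simp [smul_smul, mul_comm]

/-- For `A = I - ‖h‖⁻² h⟨h,·⟩` (the orthogonal projection onto the orthogonal
complement of `h`, `h ≠ 0`) and `B = h⟨g,·⟩` with `⟨g,h⟩ ≠ 0`, for every
`k ∈ ℂ`, `k ≠ 0`, the operator `A + ikB` is invertible and
`-(A + ikB)⁻¹(A - ikB) = -I + (2/⟨g,h⟩) h⟨g,·⟩`; in particular the latter is
independent of `k`. -/
theorem stmt_12 {n : ℕ} (h g : K n) (hh : h ≠ 0) (hgh : ⟪g, h⟫ ≠ 0)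
    (k : ℂ) (hk : k ≠ 0) :
    ∀ A B : K n →L[ℂ] K n,
      A = (1 : K n →L[ℂ] K n) -
            (((‖h‖^2 : ℝ) : ℂ))⁻¹ • (innerSL ℂ h).smulRight h →
      B = (innerSL ℂ g).smulRight h →
      (IsUnit (A + (Complex.I * k) • B) ∧
       -(Ring.inverse (A + (Complex.I * k) • B) ∘L (A - (Complex.I * k) • B)) =
         -1 + (2 / ⟪g, h⟫) • (innerSL ℂ g).smulRight h) := by
  rintro A B rfl rfl
  have hn : (((‖h‖^2 : ℝ) : ℂ)) ≠ 0 := by simpa using hh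
  have hhh : ⟪h, h⟫ = ((‖h‖^2 : ℝ) : ℂ) := by
    rw [inner_self_eq_norm_sq_to_K]; norm_cast
  have hz : Complex.I * k * ⟪g, h⟫ ≠ 0 := by simp [hk, hgh]
  have key := neg_inverse_mul_of_idempotent_pair
    (p := (((‖h‖^2 : ℝ) : ℂ))⁻¹ • (innerSL ℂ h).smulRight h)
    (q := ⟪g, h⟫⁻¹ • (innerSL ℂ g).smulRight h)
    (by rw [smul_mul_smul_comm, innerSL_smulRight_mul, hhh, smul_smul, mul_assoc,
      inv_mul_cancel₀ hn, mul_one])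
    (by rw [smul_mul_smul_comm, innerSL_smulRight_mul, smul_smul, mul_assoc,
      inv_mul_cancel₀ hgh, mul_one])
    (by rw [smul_mul_smul_comm, innerSL_smulRight_mul, hhh, smul_smul, mul_right_comm,
      inv_mul_cancel₀ hn, one_mul])
    (by rw [smul_mul_smul_comm, innerSL_smulRight_mul, smul_smul, mul_right_comm,
      inv_mul_cancel₀ hgh, one_mul]) hz
  rwa [smul_smul, smul_smul, mul_assoc, mul_inv_cancel₀ hgh, mul_one, ← div_eq_mul_inv] at key
end

section
/- Let n ≥ 1, let h := (1,1,…,1) ∈ ℂⁿ, let g ∈ ℂⁿ, let A := I be the identity on ℂⁿ, and let B be the rank-one map Bx := ⟨g,x⟩h. Then the following are equivalent: (i) for every real κ > 0, the operator A − κB is invertible and the operator norm (induced by the Euclidean norm) of (A − κB)^{−1}(A + κB) is at most 1; (ii) there exists c ∈ ℂ with Re c ≤ 0 such that g = c·h. -/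
open ContinuousLinearMap

local notation "⟪" x ", " y "⟫" => @inner ℂ _ _ x y

section Dissipative

variable {E : Type*} [NormedAddCommGroup E] [InnerProductSpace ℂ E]

lemma norm_add_le_norm_sub_iff_re_inner_nonpos (x y : E) :
    ‖x + y‖ ≤ ‖x - y‖ ↔ (inner ℂ x y).re ≤ 0 := by
  have h₁ := norm_add_sq (𝕜 := ℂ) x y
  have h₂ := norm_sub_sq (𝕜 := ℂ) x y
  simp only [RCLike.re_to_complex] at h₁ h₂
  rw [← sq_le_sq₀ (norm_nonneg _) (norm_nonneg _)]
  constructor <;> intro h <;> linarith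

/-- The Cayley transform of `T` is a contraction if and only if `T` is dissipative. -/
lemma norm_inverse_one_sub_comp_one_add_le_one_iff {T : E →L[ℂ] E} (hT : IsUnit (1 - T)) :
    ‖Ring.inverse (1 - T) ∘L (1 + T)‖ ≤ 1 ↔ ∀ y, (inner ℂ y (T y)).re ≤ 0 := by
  have hcomm : Ring.inverse (1 - T) * (1 + T) * (1 - T) = 1 + T := by
    rw [mul_assoc, show (1 + T) * (1 - T) = (1 - T) * (1 + T) by noncomm_ring, ← mul_assoc,
      Ring.inverse_mul_cancel _ hT, one_mul]
  have happ (y : E) : (Ring.inverse (1 - T) ∘L (1 + T)) (y - T y) = y + T y :=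
    DFunLike.congr_fun hcomm y
  simp only [← norm_add_le_norm_sub_iff_re_inner_nonpos]
  constructor
  · intro h y
    have := ContinuousLinearMap.le_of_opNorm_le _ h (y - T y)
    rwa [happ, one_mul] at this
  · intro h
    refine ContinuousLinearMap.opNorm_le_bound _ zero_le_one fun x ↦ ?_
    have hx : x = Ring.inverse (1 - T) x - T (Ring.inverse (1 - T) x) :=
      (DFunLike.congr_fun (Ring.mul_inverse_cancel _ hT) x).symm
    rw [one_mul, hx, happ]
    exact h _

lemma isUnit_one_sub_of_dissipative [FiniteDimensional ℂ E] {T : E →L[ℂ] E}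
    (hT : ∀ y, (inner ℂ y (T y)).re ≤ 0) : IsUnit (1 - T) := by
  have : CompleteSpace E := FiniteDimensional.complete ℂ E
  have hinj : Function.Injective (1 - T : E →L[ℂ] E) := by
    rw [injective_iff_map_eq_zero]
    intro y hy
    have hy' : T y = y := (sub_eq_zero.mp hy).symm
    have h := hT y
    rw [hy', inner_self_eq_norm_sq_to_K] at h
    norm_cast at h
    exact norm_eq_zero.mp (pow_eq_zero_iff two_ne_zero |>.mp (le_antisymm h (sq_nonneg _)))
  rw [ContinuousLinearMap.isUnit_iff_bijective]
  exact ⟨hinj, LinearMap.injective_iff_surjective (f := ((1 - T : E →L[ℂ] E) : E →ₗ[ℂ] E)).mp hinj⟩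

lemma rankOne_dissipative_iff {h : E} (hh : h ≠ 0) (g : E) :
    (∀ y, (inner ℂ y ((innerSL ℂ g).smulRight h y)).re ≤ 0) ↔
      ∃ c : ℂ, c.re ≤ 0 ∧ g = c • h := by
  simp only [ContinuousLinearMap.smulRight_apply, innerSL_apply_apply, inner_smul_right]
  constructor
  · intro H
    have hpos : 0 < ‖h‖ ^ 2 := by positivity
    obtain ⟨c, w, hw, rfl⟩ : ∃ (c : ℂ) (w : E), inner ℂ h w = 0 ∧ g = c • h + w := by
      refine ⟨inner ℂ h g / (‖h‖ : ℂ) ^ 2, g - (inner ℂ h g / (‖h‖ : ℂ) ^ 2) • h, ?_, by simp⟩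
      have : (‖h‖ : ℂ) ≠ 0 := by simpa using hh
      simp [inner_self_eq_norm_sq_to_K, this]
    have hw' : inner ℂ w h = 0 := inner_eq_zero_symm.mp hw
    have key (t : ℝ) : c.re * ‖h‖ ^ 2 + t * ‖w‖ ^ 2 ≤ 0 := by
      have := H (h + (t : ℂ) • w)
      simp only [inner_add_left, inner_add_right, inner_smul_left, inner_smul_right, hw, hw',
        inner_self_eq_norm_sq_to_K, mul_zero, add_zero, zero_add] at this
      norm_cast at this
      simp only [Complex.re_mul_ofReal, Complex.add_re, Complex.conj_re, Complex.ofReal_re,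
        Complex.coe_algebraMap, ← Complex.ofReal_mul] at this
      exact nonpos_of_mul_nonpos_left this hpos
    refine ⟨c, nonpos_of_mul_nonpos_left (by simpa using key 0) hpos, ?_⟩
    suffices w = 0 by simp [this]
    by_contra hne
    have hwpos : ‖w‖ ^ 2 ≠ 0 := by simpa using hne
    have := key ((1 - c.re * ‖h‖ ^ 2) / ‖w‖ ^ 2)
    rw [div_mul_cancel₀ _ hwpos] at this
    linarith
  · rintro ⟨c, hc, rfl⟩ y
    rw [inner_smul_left, mul_assoc, ← inner_conj_symm y h, Complex.mul_conj,
      Complex.re_mul_ofReal, Complex.conj_re]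
    exact mul_nonpos_of_nonpos_of_nonneg hc (Complex.normSq_nonneg _)

end Dissipative

/-- Let `n ≥ 1`, `h = (1,…,1)`, `A = I` and `B = h⟨g,·⟩`. Then `A - κB` is
invertible with `‖(A-κB)⁻¹(A+κB)‖ ≤ 1` for all real `κ > 0` if and only if
`g = c·h` for some `c ∈ ℂ` with `Re c ≤ 0`. -/
theorem stmt_14 {n : ℕ} (hn : 1 ≤ n) (h : K n) (hh : ∀ i, h i = 1) (g : K n) :
    (∀ κ : ℝ, 0 < κ →
        IsUnit ((1 : K n →L[ℂ] K n) - (κ : ℂ) • (innerSL ℂ g).smulRight h) ∧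
        ‖Ring.inverse ((1 : K n →L[ℂ] K n) - (κ : ℂ) • (innerSL ℂ g).smulRight h) ∘L
            ((1 : K n →L[ℂ] K n) + (κ : ℂ) • (innerSL ℂ g).smulRight h)‖ ≤ 1) ↔
    (∃ c : ℂ, c.re ≤ 0 ∧ g = c • h) := by
  have hne : h ≠ 0 := by
    rintro rfl
    simpa using hh ⟨0, hn⟩
  rw [← rankOne_dissipative_iff hne g]
  constructor
  · intro H
    obtain ⟨hu, hle⟩ := H 1 one_pos
    simp only [Complex.ofReal_one, one_smul] at hu hle
    exact (norm_inverse_one_sub_comp_one_add_le_one_iff hu).mp hle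
  · intro H κ hκ
    have hd (y : K n) : (inner ℂ y (((κ : ℂ) • (innerSL ℂ g).smulRight h) y)).re ≤ 0 := by
      rw [_root_.smul_apply, inner_smul_right, Complex.re_ofReal_mul]
      exact mul_nonpos_of_nonneg_of_nonpos hκ.le (H y)
    have hu := isUnit_one_sub_of_dissipative hd
    exact ⟨hu, (norm_inverse_one_sub_comp_one_add_le_one_iff hu).mpr hd⟩
end

section
/- Let n ≥ 1, let h := (1,1,…,1) ∈ ℂⁿ, let g ∈ ℂⁿ with ⟨g,h⟩ ≠ 0, let A := I − (1/n) h⟨h,·⟩, and let B be the rank-one map Bx := ⟨g,x⟩h. Then for every real κ > 0 the operator A − κB is invertible, and the following are equivalent: (i) for every real κ > 0, the operator norm (induced by the Euclidean norm) of (A − κB)^{−1}(A + κB) is at most 1; (ii) there exists c ∈ ℂ with c ≠ 0 such that g = c·h. -/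
open ContinuousLinearMap

local notation "⟪" x ", " y "⟫" => @inner ℂ _ _ x y

section ObliqueReflection

variable {E : Type*} [NormedAddCommGroup E] [InnerProductSpace ℂ E] {g h : E}

/-- The reflection fixing the orthogonal complement of `g` and sending `h` to `-h`
(when `⟪g, h⟫ ≠ 0`). -/
noncomputable def obliqueReflection (g h : E) : E →L[ℂ] E :=
  1 - (2 / ⟪g, h⟫) • (innerSL ℂ g).smulRight h

theorem obliqueReflection_apply (g h x : E) :
    obliqueReflection g h x = x - (2 / ⟪g, h⟫ * ⟪g, x⟫) • h := by
  simp [obliqueReflection, smul_smul]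

theorem isUnit_projection_sub_smul (hgh : ⟪g, h⟫ ≠ 0) {N k : ℂ} (hN : N ≠ 0)
    (hhh : ⟪h, h⟫ = N) (hk : k ≠ 0) :
    IsUnit ((1 : E →L[ℂ] E) - N⁻¹ • (innerSL ℂ h).smulRight h
      - k • (innerSL ℂ g).smulRight h) := by
  refine isUnit_iff_exists.mpr ⟨1 - ⟪g, h⟫⁻¹ •
    ((innerSL ℂ g).smulRight h + (N * k)⁻¹ • (innerSL ℂ h).smulRight h), ?_, ?_⟩ <;>
  · ext1 x
    simp [inner_sub_right, inner_add_right, inner_smul_right, hhh, -inner_self_eq_norm_sq_to_K]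
    match_scalars <;> field_simp
    ring

theorem projection_sub_smul_mul_obliqueReflection (hgh : ⟪g, h⟫ ≠ 0) {N k : ℂ} (hN : N ≠ 0)
    (hhh : ⟪h, h⟫ = N) :
    ((1 : E →L[ℂ] E) - N⁻¹ • (innerSL ℂ h).smulRight h
      - k • (innerSL ℂ g).smulRight h) * obliqueReflection g h =
    1 - N⁻¹ • (innerSL ℂ h).smulRight h + k • (innerSL ℂ g).smulRight h := by
  ext1 x
  simp [obliqueReflection_apply, inner_sub_right, inner_smul_right, hhh,
    -inner_self_eq_norm_sq_to_K]
  match_scalars <;> field_simp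
  ring

theorem norm_obliqueReflection_smul_le_one {c : ℂ} (hc : c ≠ 0) (hh : h ≠ 0) :
    ‖obliqueReflection (c • h) h‖ ≤ 1 := by
  have hhh : ⟪h, h⟫ ≠ 0 := inner_self_ne_zero.mpr hh
  have hc' : starRingEnd ℂ c ≠ 0 := by simpa using hc
  refine ContinuousLinearMap.opNorm_le_bound _ zero_le_one fun x => ?_
  have key : ⟪obliqueReflection (c • h) h x, obliqueReflection (c • h) h x⟫ = ⟪x, x⟫ := by
    simp only [obliqueReflection_apply, inner_sub_right, inner_sub_left, inner_smul_right,
      inner_smul_left, map_mul, map_div₀, inner_conj_symm, Complex.conj_conj, map_ofNat]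
    field_simp
    ring
  rw [inner_self_eq_norm_sq_to_K, inner_self_eq_norm_sq_to_K] at key
  have hsq : ‖obliqueReflection (c • h) h x‖ ^ 2 = ‖x‖ ^ 2 := by exact_mod_cast key
  rw [one_mul]
  exact ((sq_eq_sq₀ (norm_nonneg _) (norm_nonneg _)).mp hsq).le

theorem exists_eq_smul_of_norm_obliqueReflection_le_one (hgh : ⟪g, h⟫ ≠ 0)
    (hR : ‖obliqueReflection g h‖ ≤ 1) : ∃ c : ℂ, c ≠ 0 ∧ g = c • h := by
  have hh : h ≠ 0 := fun h0 => hgh (by simp [h0])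
  have hg : g ≠ 0 := fun h0 => hgh (by simp [h0])
  have hhh : ⟪h, h⟫ ≠ 0 := inner_self_ne_zero.mpr hh
  set x := g - (⟪h, g⟫ / ⟪h, h⟫) • h with hx
  have hhx : ⟪h, x⟫ = 0 := by
    rw [hx, inner_sub_right, inner_smul_right, div_mul_cancel₀ _ hhh, sub_self]
  have hgx : ⟪g, x⟫ = ⟪x, x⟫ := by
    conv_rhs => rw [hx, inner_sub_left, inner_smul_left, ← hx, hhx, mul_zero, sub_zero]
  have hle : ‖obliqueReflection g h x‖ ≤ ‖x‖ := by
    simpa using ContinuousLinearMap.le_of_opNorm_le _ hR x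
  have horth : ⟪x, (2 / ⟪g, h⟫ * ⟪g, x⟫) • h⟫ = 0 := by
    rw [inner_smul_right, inner_eq_zero_symm.mp hhx, mul_zero]
  have hpyth := norm_sub_sq (𝕜 := ℂ) x ((2 / ⟪g, h⟫ * ⟪g, x⟫) • h)
  rw [← obliqueReflection_apply, horth, map_zero, mul_zero, sub_zero] at hpyth
  have hzero : (2 / ⟪g, h⟫ * ⟪g, x⟫) • h = 0 := by
    rw [← norm_eq_zero]
    nlinarith [norm_nonneg ((2 / ⟪g, h⟫ * ⟪g, x⟫) • h), norm_nonneg (obliqueReflection g h x)]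
  have hx0 : x = 0 := by
    simpa [hh, hgh, hgx] using hzero
  have hgc : g = (⟪h, g⟫ / ⟪h, h⟫) • h := sub_eq_zero.mp hx0
  exact ⟨_, fun h0 => hg (by rw [hgc, h0, zero_smul]), hgc⟩

end ObliqueReflection

/-- Let `n ≥ 1`, `h = (1,…,1)`, `⟨g,h⟩ ≠ 0`, `A = I - (1/n) h⟨h,·⟩` and
`B = h⟨g,·⟩`. Then `A - κB` is invertible for all real `κ > 0`, and
`‖(A-κB)⁻¹(A+κB)‖ ≤ 1` holds for all real `κ > 0` if and only if `g = c·h` for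
some `c ∈ ℂ`, `c ≠ 0`. -/
theorem stmt_15 {n : ℕ} (hn : 1 ≤ n) (h : K n) (hh : ∀ i, h i = 1)
    (g : K n) (hgh : ⟪g, h⟫ ≠ 0) :
    ∀ A B : K n →L[ℂ] K n,
      A = (1 : K n →L[ℂ] K n) - ((n : ℂ))⁻¹ • (innerSL ℂ h).smulRight h →
      B = (innerSL ℂ g).smulRight h →
      ((∀ κ : ℝ, 0 < κ → IsUnit (A - (κ : ℂ) • B)) ∧
       ((∀ κ : ℝ, 0 < κ →
           ‖Ring.inverse (A - (κ : ℂ) • B) ∘L (A + (κ : ℂ) • B)‖ ≤ 1) ↔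
        (∃ c : ℂ, c ≠ 0 ∧ g = c • h))) := by
  rintro A B rfl rfl
  have hN : (n : ℂ) ≠ 0 := by exact_mod_cast (by lia : n ≠ 0)
  have hhh : ⟪h, h⟫ = (n : ℂ) := by
    simp [PiLp.inner_apply, hh, -inner_self_eq_norm_sq_to_K]
  have hh0 : h ≠ 0 := fun h0 => hgh (by simp [h0])
  have hunit (κ : ℝ) (hκ : 0 < κ) :=
    isUnit_projection_sub_smul (k := (κ : ℂ)) hgh hN hhh (by exact_mod_cast hκ.ne')
  refine ⟨hunit, ?_⟩
  have hR (κ : ℝ) (hκ : 0 < κ) :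
      Ring.inverse (1 - (n : ℂ)⁻¹ • (innerSL ℂ h).smulRight h
          - (κ : ℂ) • (innerSL ℂ g).smulRight h) ∘L
        (1 - (n : ℂ)⁻¹ • (innerSL ℂ h).smulRight h
          + (κ : ℂ) • (innerSL ℂ g).smulRight h) = obliqueReflection g h := by
    rw [← projection_sub_smul_mul_obliqueReflection hgh hN hhh]
    exact Ring.inverse_mul_cancel_left _ _ (hunit κ hκ)
  constructor
  · intro H
    have h1 := H 1 one_pos
    rw [hR 1 one_pos] at h1
    exact exists_eq_smul_of_norm_obliqueReflection_le_one hgh h1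
  · rintro ⟨c, hc, rfl⟩ κ hκ
    rw [hR κ hκ]
    exact norm_obliqueReflection_smul_le_one hc hh0
end

section
/- Let n ≥ 1, let h := (1,1,…,1) ∈ ℂⁿ, let α ∈ {0,−1}, let g ∈ ℂⁿ with the additional restriction ⟨g,h⟩ ≠ 0 in case α = −1, let A := I + (α/n) h⟨h,·⟩, and let B be the rank-one map Bx := ⟨g,x⟩h; for κ > 0 with A − κB invertible set 𝔖(iκ) := −(A − κB)^{−1}(A + κB). Then the following are equivalent: (i) for every real κ > 0, the operator A − κB is invertible and every component of the vector 𝔖(iκ)h is a real number ≤ 1 (i.e., 𝔖(iκ)h ≼ h componentwise); (ii) either α = −1, or α = 0 and ⟨g,h⟩ is a real number ≤ 0. Moreover, in the case α = −1 one has 𝔖(iκ)h = h for all κ > 0. -/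
open ContinuousLinearMap

local notation "⟪" x ", " y "⟫" => @inner ℂ _ _ x y

/-- A perturbation of the identity along `v` which multiplies `v` by a nonzero scalar
is invertible. -/
theorem isUnit_of_apply_eq_sub_smul {E : Type*} [NormedAddCommGroup E] [NormedSpace ℂ E]
    [FiniteDimensional ℂ E] {X : E →L[ℂ] E} {v : E} {φ : E → ℂ} {μ : ℂ}
    (hX : ∀ x, X x = x - φ x • v) (hv : X v = μ • v) (hμ : μ ≠ 0) : IsUnit X := by
  have : CompleteSpace E := FiniteDimensional.complete ℂ E
  have hinj : Function.Injective (X : E →ₗ[ℂ] E) := by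
    rw [← LinearMap.ker_eq_bot, LinearMap.ker_eq_bot']
    intro x hx
    have hx' : X x = 0 := hx
    have hxv : x = φ x • v := by rw [hX] at hx'; exact sub_eq_zero.mp hx'
    rw [hxv, map_smul, hv, smul_comm, smul_eq_zero, ← hxv] at hx'
    exact hx'.resolve_left hμ
  exact ContinuousLinearMap.isUnit_iff_bijective.mpr
    ⟨hinj, LinearMap.injective_iff_surjective.mp hinj⟩

/-- On a common eigenvector, `-X⁻¹Y` acts as minus the quotient of the eigenvalues. -/
theorem neg_inverse_comp_apply_of_eigenvector {E : Type*} [NormedAddCommGroup E]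
    [NormedSpace ℂ E] {X Y : E →L[ℂ] E} {v : E} {μ ν : ℂ} (hX : IsUnit X)
    (hXv : X v = μ • v) (hYv : Y v = ν • v) (hμ : μ ≠ 0) :
    (-(Ring.inverse X ∘L Y)) v = (-(ν / μ)) • v := by
  have h1 : Ring.inverse X (X v) = v :=
    congrArg (fun T : E →L[ℂ] E => T v) (Ring.inverse_mul_cancel X hX)
  have h2 : Ring.inverse X v = μ⁻¹ • v := by
    rw [hXv, map_smul] at h1
    rw [eq_inv_smul_iff₀ hμ, h1]
  rw [_root_.neg_apply, ContinuousLinearMap.comp_apply, hYv, map_smul, h2,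
    smul_smul, neg_smul, div_eq_mul_inv]

/-- Let `h = (1,…,1)`, `α ∈ {0,-1}`, `g ∈ ℂⁿ` (with `⟨g,h⟩ ≠ 0` if `α = -1`),
`A = I + (α/n) h⟨h,·⟩`, `B = h⟨g,·⟩`, and `𝔖(iκ) = -(A-κB)⁻¹(A+κB)`. Then
`A - κB` is invertible and `𝔖(iκ)h ≼ h` componentwise for all real `κ > 0` iff
either `α = -1`, or `α = 0` and `⟨g,h⟩` is a real number `≤ 0`. Moreover, if
`α = -1` then `𝔖(iκ)h = h` for all `κ > 0`. -/
theorem stmt_17 {n : ℕ} (hn : 1 ≤ n) (h : K n) (hh : ∀ i, h i = 1)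
    (α : ℂ) (hα : α = 0 ∨ α = -1) (g : K n) (hg : α = -1 → ⟪g, h⟫ ≠ 0) :
    ∀ A B : K n →L[ℂ] K n,
      A = (1 : K n →L[ℂ] K n) + (α / (n : ℂ)) • (innerSL ℂ h).smulRight h →
      B = (innerSL ℂ g).smulRight h →
      (((∀ κ : ℝ, 0 < κ →
            IsUnit (A - (κ : ℂ) • B) ∧
            ∀ i : Fin n,
              (((-(Ring.inverse (A - (κ : ℂ) • B) ∘L (A + (κ : ℂ) • B))) h) i).im = 0 ∧
              (((-(Ring.inverse (A - (κ : ℂ) • B) ∘L (A + (κ : ℂ) • B))) h) i).re ≤ 1) ↔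
        (α = -1 ∨ (α = 0 ∧ (⟪g, h⟫).im = 0 ∧ (⟪g, h⟫).re ≤ 0))) ∧
       (α = -1 → ∀ κ : ℝ, 0 < κ →
          IsUnit (A - (κ : ℂ) • B) ∧
          (-(Ring.inverse (A - (κ : ℂ) • B) ∘L (A + (κ : ℂ) • B))) h = h)) := by
  intro A B hA hB
  set c : ℂ := ⟪g, h⟫ with hc
  have hn0 : (n : ℂ) ≠ 0 := by exact_mod_cast (by omega : n ≠ 0)
  have hne : h ≠ 0 := by
    intro h0
    have := hh ⟨0, hn⟩
    simp [h0] at this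
  have hhh : ⟪h, h⟫ = (n : ℂ) := by
    rw [PiLp.inner_apply]
    simp [hh]
  have hAh : A h = (1 + α) • h := by
    simp [hA, hhh, smul_smul, add_smul, div_mul_cancel₀ _ hn0,
      -inner_self_eq_norm_sq_to_K]
  have hBh : B h = c • h := by simp [hB, hc]
  have hXh (κ : ℝ) : (A - (κ : ℂ) • B) h = (1 + α - κ * c) • h := by
    simp [hAh, hBh, smul_smul, sub_smul]
  have hYh (κ : ℝ) : (A + (κ : ℂ) • B) h = (1 + α + κ * c) • h := by
    simp [hAh, hBh, smul_smul, add_smul]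
  have hX (κ : ℝ) (x : K n) : (A - (κ : ℂ) • B) x =
      x - (κ * ⟪g, x⟫ - α / n * ⟪h, x⟫) • h := by
    simp only [hA, hB, _root_.sub_apply, _root_.add_apply,
      _root_.smul_apply, ContinuousLinearMap.smulRight_apply,
      one_apply_eq_self, innerSL_apply_apply]
    module
  have hunit (κ : ℝ) (hμ : 1 + α - κ * c ≠ 0) : IsUnit (A - (κ : ℂ) • B) :=
    isUnit_of_apply_eq_sub_smul (hX κ) (hXh κ) hμ
  have hμ_of_unit (κ : ℝ) (hu : IsUnit (A - (κ : ℂ) • B)) : 1 + α - κ * c ≠ 0 := by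
    intro h0
    apply hne
    apply (ContinuousLinearMap.isUnit_iff_bijective.mp hu).1
    rw [hXh, h0, zero_smul, map_zero]
  have hS (κ : ℝ) (hu : IsUnit (A - (κ : ℂ) • B)) :
      (-(Ring.inverse (A - (κ : ℂ) • B) ∘L (A + (κ : ℂ) • B))) h =
        (-((1 + α + κ * c) / (1 + α - κ * c))) • h :=
    neg_inverse_comp_apply_of_eigenvector hu (hXh κ) (hYh κ) (hμ_of_unit κ hu)
  have hneg : α = -1 → ∀ κ : ℝ, 0 < κ →
      IsUnit (A - (κ : ℂ) • B) ∧
      (-(Ring.inverse (A - (κ : ℂ) • B) ∘L (A + (κ : ℂ) • B))) h = h := by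
    intro hα1 κ hκ
    have hκc : (κ : ℂ) * c ≠ 0 := mul_ne_zero (by exact_mod_cast hκ.ne') (hg hα1)
    have hu := hunit κ (by simpa [hα1] using hκc)
    refine ⟨hu, ?_⟩
    rw [hS κ hu, hα1]
    simp [div_neg, div_self hκc]
  refine ⟨⟨fun H => ?_, ?_⟩, hneg⟩
  · rcases hα with hα0 | hα1
    · refine Or.inr ⟨hα0, ?_⟩
      have him : c.im = 0 := by
        obtain ⟨hu, hi⟩ := H 1 one_pos
        have him := (hi ⟨0, hn⟩).1
        have hμ := hμ_of_unit 1 hu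
        rw [hS 1 hu, PiLp.smul_apply, hh, hα0] at him
        simp only [hα0, add_zero, Complex.ofReal_one, one_mul] at hμ
        obtain ⟨s, hs⟩ : ∃ s : ℝ, (1 + c) / (1 - c) = s :=
          ⟨_, Complex.ext rfl (by simpa using him)⟩
        rw [div_eq_iff hμ] at hs
        have hre := congrArg Complex.re hs
        have him' := congrArg Complex.im hs
        simp at hre him'
        have h1 : c.im * (1 + s) = 0 := by linarith
        rcases mul_eq_zero.mp h1 with h2 | h2
        · exact h2
        · rw [show s = -1 by linarith] at hre
          linarith
      refine ⟨him, ?_⟩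
      by_contra! hre
      refine hμ_of_unit c.re⁻¹ (H _ (inv_pos.mpr hre)).1 ?_
      have hcre : c = (c.re : ℂ) := Complex.ext rfl (by simpa using him)
      have hcne : (c.re : ℂ) ≠ 0 := by exact_mod_cast hre.ne'
      rw [hα0, hcre, Complex.ofReal_re, Complex.ofReal_inv, inv_mul_cancel₀ hcne]
      ring
    · exact Or.inl hα1
  · rintro (hα1 | ⟨hα0, him, hre⟩) κ hκ
    · obtain ⟨hu, hSh⟩ := hneg hα1 κ hκ
      refine ⟨hu, fun i => ?_⟩
      rw [hSh, hh]
      simp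
    · have hcre : c = (c.re : ℂ) := Complex.ext rfl (by simpa using him)
      have hpos : 0 < 1 - κ * c.re := by nlinarith
      have hμ : 1 + α - κ * c ≠ 0 := by
        rw [hα0, hcre, add_zero]
        exact_mod_cast hpos.ne'
      have hu := hunit κ hμ
      have hq : -((1 + α + κ * c) / (1 + α - κ * c)) =
          ((-((1 + κ * c.re) / (1 - κ * c.re)) : ℝ) : ℂ) := by
        rw [hα0, hcre]
        simp
      refine ⟨hu, fun i => ?_⟩
      rw [hS κ hu, PiLp.smul_apply, hh, hq, smul_eq_mul, mul_one]
      refine ⟨Complex.ofReal_im _, ?_⟩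
      rw [Complex.ofReal_re, ← neg_div, div_le_one hpos]
      linarith
end

section
/- Let n ≥ 1, let h := (1,1,…,1) ∈ ℂⁿ, let α ∈ {0,−1}, let g ∈ ℂⁿ with the additional restriction ⟨g,h⟩ ≠ 0 in case α = −1, let A := I + (α/n) h⟨h,·⟩, and let B be the rank-one map Bx := ⟨g,x⟩h; for κ > 0 with A − κB invertible set 𝔖(iκ) := −(A − κB)^{−1}(A + κB). Assume that for every real κ > 0 the operator A − κB is invertible and every component of 𝔖(iκ)h is a real number ≤ 1. Then exactly one of the following holds: either for every κ > 0 every component of 𝔖(iκ)h is a real number strictly less than 1, or for every κ > 0 one has 𝔖(iκ)h = h. -/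
open ContinuousLinearMap

local notation "⟪" x ", " y "⟫" => @inner ℂ _ _ x y

/-- The Cayley-type transform `-T⁻¹(A + C)` with `T = A - C` equals `I - 2 T⁻¹ A`. -/
theorem neg_inverse_sub_comp_add_apply {E : Type*} [NormedAddCommGroup E] [NormedSpace ℂ E]
    {A C : E →L[ℂ] E} (hu : IsUnit (A - C)) (x : E) :
    (-(Ring.inverse (A - C) ∘L (A + C))) x = x - (2 : ℂ) • Ring.inverse (A - C) (A x) := by
  have hinv : Ring.inverse (A - C) ((A - C) x) = x :=
    DFunLike.congr_fun (Ring.inverse_mul_cancel _ hu) x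
  have hsum : (A + C) x = (2 : ℂ) • A x - (A - C) x := by
    simp only [add_apply, sub_apply, two_smul]
    abel
  rw [neg_apply, comp_apply, hsum, map_sub, map_smul, hinv]
  abel

/-- Let `h = (1,…,1)`, `α ∈ {0,-1}`, `g ∈ ℂⁿ` (with `⟨g,h⟩ ≠ 0` if `α = -1`),
`A = I + (α/n) h⟨h,·⟩`, `B = h⟨g,·⟩`, and `𝔖(iκ) = -(A-κB)⁻¹(A+κB)`. If for
every real `κ > 0` the operator `A - κB` is invertible and every component of
`𝔖(iκ)h` is a real number `≤ 1`, then exactly one of the following holds: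
either for every `κ > 0` each component of `𝔖(iκ)h` is a real number `< 1`, or
`𝔖(iκ)h = h` for every `κ > 0`. -/
theorem stmt_18 {n : ℕ} (hn : 1 ≤ n) (h : K n) (hh : ∀ i, h i = 1)
    (α : ℂ) (hα : α = 0 ∨ α = -1) (g : K n) (hg : α = -1 → ⟪g, h⟫ ≠ 0)
    (A B : K n →L[ℂ] K n)
    (hA : A = (1 : K n →L[ℂ] K n) + (α / (n : ℂ)) • (innerSL ℂ h).smulRight h)
    (hB : B = (innerSL ℂ g).smulRight h)
    (hyp : ∀ κ : ℝ, 0 < κ →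
      IsUnit (A - (κ : ℂ) • B) ∧
      ∀ i : Fin n,
        (((-(Ring.inverse (A - (κ : ℂ) • B) ∘L (A + (κ : ℂ) • B))) h) i).im = 0 ∧
        (((-(Ring.inverse (A - (κ : ℂ) • B) ∘L (A + (κ : ℂ) • B))) h) i).re ≤ 1) :
    Xor'
      (∀ κ : ℝ, 0 < κ → ∀ i : Fin n,
        (((-(Ring.inverse (A - (κ : ℂ) • B) ∘L (A + (κ : ℂ) • B))) h) i).im = 0 ∧
        (((-(Ring.inverse (A - (κ : ℂ) • B) ∘L (A + (κ : ℂ) • B))) h) i).re < 1)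
      (∀ κ : ℝ, 0 < κ →
        (-(Ring.inverse (A - (κ : ℂ) • B) ∘L (A + (κ : ℂ) • B))) h = h) := by
  have hne : (n : ℂ) ≠ 0 := Nat.cast_ne_zero.mpr (by omega)
  have hnorm : ⟪h, h⟫ = n := by
    simp only [PiLp.inner_apply, hh]
    simp
  have hAh : A h = (1 + α) • h := by
    rw [hA]
    simp only [add_apply, one_apply_eq_self, smul_apply, smulRight_apply, innerSL_apply_apply, hnorm,
      smul_smul, div_mul_cancel₀ α hne, add_smul, one_smul]
  rcases hα with rfl | rfl
  · have hS : ∀ κ : ℝ, 0 < κ → ∀ i : Fin n,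
        ((-(Ring.inverse (A - (κ : ℂ) • B) ∘L (A + (κ : ℂ) • B))) h) i ≠ 1 := by
      intro κ hκ i
      have hu := (hyp κ hκ).1
      have hTh : (A - (κ : ℂ) • B) h = (1 - κ * ⟪g, h⟫) • h := by
        rw [sub_apply, hAh, hB]
        simp [sub_smul, smul_smul]
      have hinv : Ring.inverse (A - (κ : ℂ) • B) ((A - (κ : ℂ) • B) h) = h :=
        DFunLike.congr_fun (Ring.inverse_mul_cancel _ hu) h
      rw [hTh, map_smul] at hinv
      have hcomp : (1 - κ * ⟪g, h⟫) * (Ring.inverse (A - (κ : ℂ) • B) h) i = 1 := by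
        rw [← hh i, ← smul_eq_mul, ← PiLp.smul_apply, hh i, hinv, hh i]
      rw [neg_inverse_sub_comp_add_apply hu, hAh, add_zero, one_smul, PiLp.sub_apply,
        PiLp.smul_apply, hh i, smul_eq_mul]
      intro hone
      have hzero : (Ring.inverse (A - (κ : ℂ) • B) h) i = 0 := by linear_combination -hone / 2
      simp [hzero] at hcomp
    refine Or.inl ⟨fun κ hκ i => ?_, fun hfix => ?_⟩
    · obtain ⟨him, hre⟩ := (hyp κ hκ).2 i
      exact ⟨him, lt_of_le_of_ne hre fun hone => hS κ hκ i (Complex.ext hone him)⟩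
    · apply hS 1 one_pos ⟨0, hn⟩
      rw [hfix 1 one_pos, hh]
  · have hfix : ∀ κ : ℝ, 0 < κ →
        (-(Ring.inverse (A - (κ : ℂ) • B) ∘L (A + (κ : ℂ) • B))) h = h := by
      intro κ hκ
      rw [neg_inverse_sub_comp_add_apply (hyp κ hκ).1, hAh]
      simp
    refine Or.inr ⟨hfix, fun hlt => ?_⟩
    have hlt' := (hlt 1 one_pos ⟨0, hn⟩).2
    rw [hfix 1 one_pos, hh, Complex.one_re] at hlt'
    exact lt_irrefl _ hlt'
end
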